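/- Let ABCD be a tetrahedron with M on edge AB, N on edge BC, K on edge CD, L on edge DA dividing the edges in ratios x = |CK|/|KD|, y = |DL|/|LA|, z = |AM|/|MB|, t = |BN|/|NC|. The four points K, L, M, N are coplanar if and only if xyzt = 1. -/

import Mathlib

open MeasureTheory

noncomputable def tetVol (A B C D : EuclideanSpace ℝ (Fin 3)) : ℝ :=
  (volume (convexHull ℝ {A, B, C, D})).toReal

theorem one_add_smul_eq_of_dist_div_dist {E : Type*} [NormedAddCommGroup E] [NormedSpace ℝ E]
    {X Y P : E} {r : ℝ} (hP : P ∈ segment ℝ X Y) (hPY : P ≠ Y)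
    (hr : dist X P / dist P Y = r) : (1 + r) • P = X + r • Y := by
  obtain ⟨a, b, ha, hb, hab, rfl⟩ := hP
  obtain rfl : a = 1 - b := by linarith
  have hXP : dist X ((1 - b) • X + b • Y) = b * dist X Y := by
    rw [dist_eq_norm, dist_eq_norm, show X - ((1 - b) • X + b • Y) = b • (X - Y) by module,
      norm_smul, Real.norm_of_nonneg hb]
  have hYP : dist ((1 - b) • X + b • Y) Y = (1 - b) * dist X Y := by
    rw [dist_eq_norm, dist_eq_norm, show (1 - b) • X + b • Y - Y = (1 - b) • (X - Y) by module,
      norm_smul, Real.norm_of_nonneg ha]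
  have hne : (1 - b) * dist X Y ≠ 0 := by
    rw [← hYP]
    exact dist_ne_zero.mpr hPY
  have hd : dist X Y ≠ 0 := right_ne_zero_of_mul hne
  have hrb : r * (1 - b) = b := by
    rw [hXP, hYP, div_eq_iff hne] at hr
    apply mul_right_cancel₀ hd
    linarith
  have h₁ : (1 + r) * (1 - b) = 1 := by linarith
  have h₂ : (1 + r) * b = r := by linarith
  rw [smul_add, smul_smul, smul_smul, h₁, h₂, one_smul]

theorem affineIndependent_fin_four_iff {V : Type*} [AddCommGroup V] [Module ℝ V]
    (P Q R S : V) : AffineIndependent ℝ ![P, Q, R, S] ↔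
      ∀ p q r s : ℝ, p + q + r + s = 0 → p • P + q • Q + r • R + s • S = 0 →
        p = 0 ∧ q = 0 ∧ r = 0 ∧ s = 0 := by
  rw [affineIndependent_iff_of_fintype]
  constructor
  · intro h p q r s hsum hzero
    have hw : ∑ i, ![p, q, r, s] i = 0 := by simpa [Fin.sum_univ_four] using hsum
    have key := h ![p, q, r, s] hw (by
      rw [Finset.weightedVSub_eq_linear_combination _ hw]
      simpa [Fin.sum_univ_four] using hzero)
    exact ⟨key 0, key 1, key 2, key 3⟩
  · intro h w hw hzero
    rw [Finset.weightedVSub_eq_linear_combination _ hw] at hzero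
    obtain ⟨h0, h1, h2, h3⟩ := h (w 0) (w 1) (w 2) (w 3)
      (by simpa [Fin.sum_univ_four] using hw) (by simpa [Fin.sum_univ_four] using hzero)
    intro i
    fin_cases i <;> assumption

theorem coplanar_iff_not_affineIndependent_fin_four {V : Type*} [AddCommGroup V] [Module ℝ V]
    (P Q R S : V) : Coplanar ℝ {P, Q, R, S} ↔ ¬ AffineIndependent ℝ ![P, Q, R, S] := by
  have hrange : Set.range ![P, Q, R, S] = {P, Q, R, S} := by
    simp only [Matrix.range_cons, Matrix.range_empty, Set.union_empty, Set.singleton_union]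
  have : FiniteDimensional ℝ (vectorSpan ℝ ({P, Q, R, S} : Set V)) :=
    finiteDimensional_vectorSpan_of_finite ℝ (Set.toFinite _)
  rw [coplanar_iff_finrank_le_two, ← hrange,
    finrank_vectorSpan_le_iff_not_affineIndependent ℝ _ (Fintype.card_fin 4)]

theorem menelaus_tetrahedron
    (A B C D M N K L : EuclideanSpace ℝ (Fin 3)) (x y z t : ℝ)
    (hABCD : AffineIndependent ℝ ![A, B, C, D])
    (hx : 0 < x) (hy : 0 < y) (hz : 0 < z) (ht : 0 < t)
    (hM : M ∈ segment ℝ A B) (hMA : M ≠ A) (hMB : M ≠ B)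
    (hN : N ∈ segment ℝ B C) (hNB : N ≠ B) (hNC : N ≠ C)
    (hK : K ∈ segment ℝ C D) (hKC : K ≠ C) (hKD : K ≠ D)
    (hL : L ∈ segment ℝ D A) (hLD : L ≠ D) (hLA : L ≠ A)
    (hxr : dist C K / dist K D = x)
    (hyr : dist D L / dist L A = y)
    (hzr : dist A M / dist M B = z)
    (htr : dist B N / dist N C = t) :
    Coplanar ℝ {K, L, M, N} ↔ x * y * z * t = 1 := by
  have eM := one_add_smul_eq_of_dist_div_dist hM hMB hzr
  have eN := one_add_smul_eq_of_dist_div_dist hN hNC htr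
  have eK := one_add_smul_eq_of_dist_div_dist hK hKD hxr
  have eL := one_add_smul_eq_of_dist_div_dist hL hLA hyr
  rw [coplanar_iff_not_affineIndependent_fin_four, affineIndependent_fin_four_iff]
  rw [affineIndependent_fin_four_iff] at hABCD
  constructor
  · intro hdep
    by_contra hne
    refine hdep fun k l m n hsum hzero => ?_
    obtain ⟨k, rfl⟩ : ∃ k', k = k' * (1 + x) := ⟨k / (1 + x), by field_simp⟩
    obtain ⟨l, rfl⟩ : ∃ l', l = l' * (1 + y) := ⟨l / (1 + y), by field_simp⟩
    obtain ⟨m, rfl⟩ : ∃ m', m = m' * (1 + z) := ⟨m / (1 + z), by field_simp⟩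
    obtain ⟨n, rfl⟩ : ∃ n', n = n' * (1 + t) := ⟨n / (1 + t), by field_simp⟩
    simp only [mul_smul, eK, eL, eM, eN] at hzero
    obtain ⟨hA, hB, hC, hD⟩ := hABCD (y * l + m) (z * m + n) (t * n + k) (x * k + l)
      (by linarith) (by rw [← hzero]; module)
    have hm : m = 0 := by
      have h : (x * y * z * t - 1) * m = 0 := by
        linear_combination x * y * t * hB - x * y * hC + y * hD - hA
      exact (mul_eq_zero.mp h).resolve_left (sub_ne_zero.mpr hne)
    subst hm
    have hn : n = 0 := by linarith
    subst hn
    have hk : k = 0 := by linarith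
    subst hk
    have hl : l = 0 := by linarith
    subst hl
    simp
  · intro hprod hind
    have hzero : (t * z * (1 + x)) • K + (-(x * t * z) * (1 + y)) • L + (1 + z) • M +
        (-z * (1 + t)) • N = 0 := by
      simp only [mul_smul _ (1 + x), mul_smul _ (1 + y), mul_smul _ (1 + t), eK, eL, eM, eN]
      have hA : -(x * t * z) * y + 1 = 0 := by linear_combination -hprod
      calc _ = (-(x * t * z) * y + 1) • A := by module
        _ = 0 := by rw [hA, zero_smul]
    obtain ⟨-, -, h, -⟩ := hind _ _ _ _ (by linear_combination -hprod) hzero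
    linarith
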